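/- arXiv:1510.07825 — 8 statements merged into one kernel-verified Lean document; each statement's English description precedes it below -/
import Mathlib

section
/- Let n ≥ 1 and let G be a simple graph on Fin n. The zero-indexed target basis vector e none lies in the real linear span of the available vectors of the bipartiteness span program P1 if and only if G is not bipartite (equivalently, G is not 2-colorable). -/
/-- The standard basis vector `e i` in the space `H₁ = (Option (Fin n × Fin n × Bool)) → ℝ`. -/
noncomputable def e1 (n : ℕ) (i : Option (Fin n × Fin n × Bool)) :
    Option (Fin n × Fin n × Bool) → ℝ :=
  Pi.single i 1

/-- The available vectors of the bipartiteness span program `P1`. -/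
noncomputable def P1avail (n : ℕ) (G : SimpleGraph (Fin n)) :
    Set (Option (Fin n × Fin n × Bool) → ℝ) :=
  {x | (∃ k : Fin n,
          x = e1 n none + e1 n (some (k, k, false)) + e1 n (some (k, k, true))) ∨
       (∃ k u v : Fin n, G.Adj u v ∧
          x = e1 n (some (u, k, false)) + e1 n (some (v, k, true)))}

theorem edge_mem_span_P1avail {n : ℕ} {G : SimpleGraph (Fin n)} {u v : Fin n} (h : G.Adj u v)
    (k : Fin n) (b : Bool) :
    e1 n (some (u, k, b)) + e1 n (some (v, k, !b)) ∈ Submodule.span ℝ (P1avail n G) := by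
  apply Submodule.subset_span
  cases b with
  | false => exact Or.inr ⟨k, u, v, h, rfl⟩
  | true => exact Or.inr ⟨k, v, u, h.symm, add_comm _ _⟩

/-- The alternating sum of the edge vectors along a walk telescopes to its endpoints. -/
theorem walk_mem_span_P1avail {n : ℕ} {G : SimpleGraph (Fin n)} (k : Fin n) {u v : Fin n}
    (p : G.Walk u v) (b : Bool) :
    (Even p.length →
      e1 n (some (u, k, b)) - e1 n (some (v, k, b)) ∈ Submodule.span ℝ (P1avail n G)) ∧
    (Odd p.length →
      e1 n (some (u, k, b)) + e1 n (some (v, k, !b)) ∈ Submodule.span ℝ (P1avail n G)) := by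
  induction p generalizing b with
  | nil => simp
  | cons h p ih =>
    have hedge := edge_mem_span_P1avail h k b
    obtain ⟨heven, hodd⟩ := ih (!b)
    rw [SimpleGraph.Walk.length_cons, Nat.even_add_one, Nat.odd_add_one, Nat.not_even_iff_odd,
      Nat.not_odd_iff_even]
    constructor
    · intro hp
      have key := Submodule.sub_mem _ hedge (hodd hp)
      rw [Bool.not_not] at key
      convert key using 1
      abel
    · intro hp
      have key := Submodule.sub_mem _ hedge (heven hp)
      convert key using 1
      abel

/-- A `2`-coloring yields a linear functional that vanishes on the available vectors but not on
the target. -/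
theorem target_notMem_span_P1avail {n : ℕ} {G : SimpleGraph (Fin n)} (c : G.Coloring (Fin 2)) :
    e1 n none ∉ Submodule.span ℝ (P1avail n G) := by
  intro hmem
  let w : Option (Fin n × Fin n × Bool) → ℝ :=
    fun i => i.elim 1 fun x => if c x.1 = c x.2.1 then -1 / 2 else 1 / 2
  have hw : ∀ i, Fintype.linearCombination ℝ w (e1 n i) = w i := fun i => by
    simp [e1, Fintype.linearCombination_apply_single]
  have hle : Submodule.span ℝ (P1avail n G) ≤
      LinearMap.ker (Fintype.linearCombination ℝ w) := by
    rw [Submodule.span_le]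
    rintro x (⟨k, rfl⟩ | ⟨k, u, v, h, rfl⟩)
    · simp only [SetLike.mem_coe, LinearMap.mem_ker, map_add, hw]
      norm_num [w]
    · have hc := c.valid h
      simp only [SetLike.mem_coe, LinearMap.mem_ker, map_add, hw]
      by_cases hu : c u = c k <;> by_cases hv : c v = c k
      · exact absurd (hu.trans hv.symm) hc
      · norm_num [w, hu, hv]
      · norm_num [w, hu, hv]
      · omega
  have h0 := hle hmem
  rw [LinearMap.mem_ker, hw] at h0
  exact one_ne_zero h0

theorem stmt0 (n : ℕ) (hn : 1 ≤ n) (G : SimpleGraph (Fin n)) :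
    e1 n none ∈ Submodule.span ℝ (P1avail n G) ↔ ¬ G.Colorable 2 := by
  constructor
  · rintro hmem ⟨c⟩
    exact target_notMem_span_P1avail c hmem
  · intro hG
    rw [SimpleGraph.two_colorable_iff_forall_loop_even] at hG
    push Not at hG
    obtain ⟨k, p, hp⟩ := hG
    have hloop := (walk_mem_span_P1avail k p false).2 (by simpa using hp)
    have hfree : e1 n none + e1 n (some (k, k, false)) + e1 n (some (k, k, true)) ∈
        Submodule.span ℝ (P1avail n G) := Submodule.subset_span (Or.inl ⟨k, rfl⟩)
    rw [add_assoc] at hfree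
    exact (Submodule.add_mem_iff_left _ hloop).1 hfree
end

section
/- Let n ≥ 1 and let G be a simple graph on Fin n that is not bipartite. Then there exists a finitely supported family of real coefficients, one for each available vector of the bipartiteness span program P1, such that the corresponding linear combination of available vectors equals e none and the sum of the squares of the coefficients is at most 2. -/
/-- The vectors of the bipartiteness span program `P1`, indexed by
`Sum.inl k` for the free vector attached to `k`, and by `Sum.inr (k, u, v)` for the
vector attached to subspace `k` and the ordered pair `(u, v)`. -/
noncomputable def P1vec (n : ℕ) :
    (Fin n ⊕ Fin n × Fin n × Fin n) → Option (Fin n × Fin n × Bool) → ℝ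
  | Sum.inl k => e1 n none + e1 n (some (k, k, false)) + e1 n (some (k, k, true))
  | Sum.inr (k, u, v) => e1 n (some (u, k, false)) + e1 n (some (v, k, true))

/-- Repeating a closed segment of length `m` periodically. -/
theorem SimpleGraph.exists_periodic_of_closed {V : Type*} {G : SimpleGraph V} {m : ℕ} (hm : 0 < m)
    (f : ℕ → V) (hadj : ∀ i < m, G.Adj (f i) (f (i + 1))) (hclosed : f m = f 0) :
    ∃ g : ℕ → V, (∀ i, G.Adj (g i) (g (i + 1))) ∧ g.Periodic m := by
  refine ⟨fun t => f (t % m), fun t => ?_, fun t => by simp⟩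
  have hlt := Nat.mod_lt t hm
  have h := hadj _ hlt
  rcases Nat.lt_or_ge (t % m + 1) m with h1 | h1
  · rwa [← Nat.mod_eq_of_lt h1, Nat.mod_add_mod] at h
  · have h2 : t % m + 1 = m := by omega
    have h3 : (t + 1) % m = 0 := by rw [← Nat.mod_add_mod, h2, Nat.mod_self]
    simp only [h3]
    rwa [h2, hclosed] at h

/-- A graph that is not 2-colorable contains an odd cycle, given here as a periodic sequence of
vertices without repetition within a period. -/
theorem SimpleGraph.exists_odd_cycle_of_not_colorable_two {V : Type*} {G : SimpleGraph V}
    (hG : ¬ G.Colorable 2) :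
    ∃ (d : ℕ) (f : ℕ → V), Odd d ∧ (∀ i, G.Adj (f i) (f (i + 1))) ∧ f.Periodic d ∧
      ∀ i j, f i = f j → i ≡ j [MOD d] := by
  classical
  have hex : ∃ d : ℕ, Odd d ∧ ∃ f : ℕ → V, (∀ i, G.Adj (f i) (f (i + 1))) ∧ f.Periodic d := by
    rw [two_colorable_iff_forall_loop_even] at hG
    simp only [not_forall, Nat.not_even_iff_odd] at hG
    obtain ⟨u, w, hw⟩ := hG
    exact ⟨w.length, hw, exists_periodic_of_closed hw.pos w.getVert
      (fun i hi => w.adj_getVert_succ hi) (by simp)⟩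
  obtain ⟨hd, f, hadj, hper⟩ := Nat.find_spec hex
  set d := Nat.find hex
  have hmin : ∀ i m, Odd m → m < d → f (i + m) ≠ f i := fun i m hm hlt heq =>
    Nat.find_min hex hlt ⟨hm, exists_periodic_of_closed hm.pos (fun t => f (i + t))
      (fun t _ => hadj (i + t)) heq⟩
  have hne : ∀ i j, i < j → j < d → f i ≠ f j := by
    intro i j hij hjd heq
    obtain ⟨m, rfl⟩ := Nat.exists_eq_add_of_lt hij
    rcases Nat.even_or_odd (m + 1) with hm | hm
    · refine hmin (i + m + 1) (d - (m + 1)) (Nat.Odd.sub_even (by omega) hd hm) (by omega) ?_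
      rw [← heq, ← hper i]
      congr 1
      omega
    · exact hmin i (m + 1) hm (by omega) heq.symm
  refine ⟨d, f, hd, hadj, hper, fun i j hij => ?_⟩
  rw [← hper.map_mod_nat i, ← hper.map_mod_nat j] at hij
  have hi := Nat.mod_lt i hd.pos
  have hj := Nat.mod_lt j hd.pos
  rcases lt_trichotomy (i % d) (j % d) with h | h | h
  · exact absurd hij (hne _ _ h hj)
  · exact h
  · exact absurd hij.symm (hne _ _ h hi)

theorem sum_range_neg_one_pow_smul_add_succ {M : Type*} [AddCommGroup M] [Module ℝ M]
    (w : ℕ → M) (d : ℕ) :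
    ∑ i ∈ Finset.range d, (-1 : ℝ) ^ i • (w i + w (i + 1)) = w 0 - (-1 : ℝ) ^ d • w d := by
  induction d with
  | zero => simp
  | succ d ih =>
    rw [Finset.sum_range_succ, ih, pow_succ]
    module

/-- The index of the `i`-th edge of the closed walk `f` based at `f j`, oriented so that the vertex
at even position comes first. -/
def cycleEdge {n : ℕ} (f : ℕ → Fin n) (j i : ℕ) : Fin n × Fin n × Fin n :=
  if Even i then (f j, f (j + i), f (j + i + 1)) else (f j, f (j + i + 1), f (j + i))

theorem P1vec_cycleEdge {n : ℕ} (f : ℕ → Fin n) (j i : ℕ) :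
    P1vec n (Sum.inr (cycleEdge f j i)) =
      e1 n (some (f (j + i), f j, decide (Odd i))) +
        e1 n (some (f (j + (i + 1)), f j, decide (Odd (i + 1)))) := by
  rcases Nat.even_or_odd i with h | h
  · have h1 : ¬ Odd i := Nat.not_odd_iff_even.2 h
    have h2 : Odd (i + 1) := h.add_one
    simp [cycleEdge, P1vec, h, h1, h2, add_assoc]
  · have h1 : ¬ Even i := Nat.not_even_iff_odd.2 h
    have h2 : ¬ Odd (i + 1) := Nat.not_odd_iff_even.2 h.add_one
    simp [cycleEdge, P1vec, h, h1, h2, add_assoc, add_comm]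

theorem cycleEdge_injective {n d : ℕ} (hd : Odd d) (f : ℕ → Fin n)
    (hf : ∀ i j, f i = f j → i ≡ j [MOD d]) :
    Function.Injective fun p : Fin d × Fin d => cycleEdge f p.1 p.2 := by
  have hfin : ∀ a b : Fin d, f a = f b → a = b := fun a b h =>
    Fin.ext ((hf _ _ h).eq_of_lt_of_lt a.2 b.2)
  have hcross : ∀ j : ℕ, ∀ a b : Fin d, f (j + a) = f (j + b + 1) → f (j + a + 1) = f (j + b) →
      a = b := by
    intro j a b h1 h2
    have h3 := (Nat.modEq_iff_dvd.1 (hf _ _ h1)).sub (Nat.modEq_iff_dvd.1 (hf _ _ h2))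
    push_cast at h3
    ring_nf at h3
    have h4 : d ∣ 2 := by exact_mod_cast h3
    have h5 := Nat.le_of_dvd two_pos h4
    obtain ⟨k, hk⟩ := hd
    apply Fin.ext
    omega
  have hsame : ∀ j : ℕ, ∀ a b : Fin d, f (j + a) = f (j + b) → a = b := fun j a b h =>
    Fin.ext ((Nat.ModEq.add_left_cancel' j (hf _ _ h)).eq_of_lt_of_lt a.2 b.2)
  rintro ⟨j, a⟩ ⟨j', b⟩ h
  obtain rfl : j = j' := hfin _ _ (by
    simp only [cycleEdge] at h
    split_ifs at h <;> exact congrArg Prod.fst h)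
  simp only [cycleEdge] at h
  split_ifs at h <;> simp only [Prod.mk.injEq, true_and] at h
  · rw [hsame j a b h.1]
  · rw [hcross j a b h.1 h.2]
  · rw [hcross j a b h.2 h.1]
  · rw [hsame j a b h.2]

theorem stmt1 (n : ℕ) (hn : 1 ≤ n) (G : SimpleGraph (Fin n))
    (hG : ¬ G.Colorable 2) :
    ∃ c : (Fin n ⊕ Fin n × Fin n × Fin n) → ℝ,
      (∀ k u v : Fin n, ¬ G.Adj u v → c (Sum.inr (k, u, v)) = 0) ∧
      (∑ i, c i • P1vec n i) = e1 n none ∧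
      (∑ i, (c i) ^ 2) ≤ 2 := by
  classical
  obtain ⟨d, f, hd, hadj, hper, hf⟩ := SimpleGraph.exists_odd_cycle_of_not_colorable_two hG
  have hd0 : (d : ℝ) ≠ 0 := by exact_mod_cast hd.pos.ne'
  let φ : Fin d ⊕ Fin d × Fin d → Fin n ⊕ Fin n × Fin n × Fin n :=
    Sum.map (fun j => f j) (fun p => cycleEdge f p.1 p.2)
  let a : Fin d ⊕ Fin d × Fin d → ℝ :=
    Sum.elim (fun _ => (d : ℝ)⁻¹) (fun p => -((d : ℝ)⁻¹ * (-1) ^ (p.2 : ℕ)))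
  have hφ : Function.Injective φ := Sum.map_injective.2
    ⟨fun i j h => Fin.ext ((hf _ _ h).eq_of_lt_of_lt i.2 j.2), cycleEdge_injective hd f hf⟩
  have hoff : ∀ x ∉ Set.range φ, Function.extend φ a 0 x = 0 := fun x hx =>
    Function.extend_apply' _ _ _ hx
  refine ⟨Function.extend φ a 0, fun k u v huv => hoff _ ?_, ?_, ?_⟩
  · rintro ⟨j | ⟨j, i⟩, h⟩
    · simp [φ] at h
    · simp only [φ, Sum.map_inr, Sum.inr.injEq, cycleEdge] at h
      split_ifs at h <;> simp only [Prod.mk.injEq] at h <;> obtain ⟨-, rfl, rfl⟩ := h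
      · exact huv (hadj _)
      · exact huv (hadj _).symm
  · rw [← Fintype.sum_of_injective φ hφ (fun x => a x • P1vec n (φ x)) _
      (fun x hx => by rw [hoff x hx, zero_smul]) (fun x => by rw [hφ.extend_apply])]
    rw [Fintype.sum_sum_type, Fintype.sum_prod_type, ← Finset.sum_add_distrib]
    have hterm : ∀ j : Fin d, a (Sum.inl j) • P1vec n (φ (Sum.inl j)) +
        ∑ i : Fin d, a (Sum.inr (j, i)) • P1vec n (φ (Sum.inr (j, i))) =
          (d : ℝ)⁻¹ • e1 n none := by
      intro j
      have hsum := sum_range_neg_one_pow_smul_add_succ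
        (fun i => e1 n (some (f (j + i), f j, decide (Odd i)))) d
      simp only [← P1vec_cycleEdge, hper (j : ℕ), hd, hd.neg_one_pow] at hsum
      rw [← Fin.sum_univ_eq_sum_range
        (fun i => (-1 : ℝ) ^ i • P1vec n (Sum.inr (cycleEdge f j i)))] at hsum
      simp only [a, φ, Sum.elim_inl, Sum.elim_inr, Sum.map_inl, Sum.map_inr, neg_smul, mul_smul,
        Finset.sum_neg_distrib, ← Finset.smul_sum, hsum]
      simp only [P1vec, add_zero, Nat.not_odd_zero, decide_false, decide_true]
      module
    rw [Finset.sum_congr rfl fun j _ => hterm j, Finset.sum_const, Finset.card_univ,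
      Fintype.card_fin, ← Nat.cast_smul_eq_nsmul ℝ, smul_smul, mul_inv_cancel₀ hd0, one_smul]
  · rw [← Fintype.sum_of_injective φ hφ (fun x => a x ^ 2) _
      (fun x hx => by rw [hoff x hx, zero_pow two_ne_zero]) (fun x => by rw [hφ.extend_apply])]
    have hd1 : (1 : ℝ) ≤ d := by exact_mod_cast hd.pos
    have hinv : (d : ℝ)⁻¹ ≤ 1 := inv_le_one_of_one_le₀ hd1
    have hval : ∑ x, a x ^ 2 = (d : ℝ)⁻¹ + 1 := by
      simp only [a, Fintype.sum_sum_type, Sum.elim_inl, Sum.elim_inr, neg_sq, mul_pow, ← pow_mul,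
        mul_comm _ 2, pow_mul (-1 : ℝ) 2, one_pow, mul_one, Finset.sum_const, Finset.card_univ,
        Fintype.card_prod, Fintype.card_fin, nsmul_eq_mul, Nat.cast_mul]
      field_simp
    linarith
end

section
/- Let n ≥ 1 and let G be a simple graph on Fin n that is bipartite. Then there exists a vector w : Option (Fin n × Fin n × Bool) → ℝ such that: the inner product of w with e none equals 1; the inner product of w with every available vector of the bipartiteness span program P1 is 0; and the sum, over all k : Fin n and all ordered pairs (u,v) of distinct vertices, of the square of the inner product of w with e (some (u,k,false)) + e (some (v,k,true)), plus the sum over all k of the square of the inner product of w with the free vector e none + e (some (k,k,false)) + e (some (k,k,true)), is at most n + n³. -/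
/-- The inner product on `H₁`. -/
noncomputable def ip1 (n : ℕ) (w x : Option (Fin n × Fin n × Bool) → ℝ) : ℝ :=
  ∑ i, w i * x i

theorem ip1_e1 (n : ℕ) (w : Option (Fin n × Fin n × Bool) → ℝ)
    (i : Option (Fin n × Fin n × Bool)) : ip1 n w (e1 n i) = w i := by
  simp [ip1, e1, Pi.single_apply]

theorem ip1_add (n : ℕ) (w x y : Option (Fin n × Fin n × Bool) → ℝ) :
    ip1 n w (x + y) = ip1 n w x + ip1 n w y := by
  simp [ip1, mul_add, Finset.sum_add_distrib]

/-- A 2-colorable graph admits a sign function that changes along every edge. -/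
theorem SimpleGraph.Colorable.exists_sign {V : Type*} {G : SimpleGraph V}
    (hG : G.Colorable 2) :
    ∃ s : V → ℝ, (∀ u, s u = 1 ∨ s u = -1) ∧ ∀ u v, G.Adj u v → s u + s v = 0 := by
  obtain ⟨c⟩ := hG
  refine ⟨fun u => if c u = 0 then 1 else -1, fun u => ?_, fun u v h => ?_⟩
  · by_cases h : c u = 0 <;> simp [h]
  · have hc : c u ≠ c v := c.valid h
    by_cases hu : c u = 0 <;> by_cases hv : c v = 0
    · exact absurd (hu.trans hv.symm) hc
    · simp [hu, hv]
    · simp [hu, hv]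
    · exact absurd (by omega) hc

theorem stmt2 (n : ℕ) (hn : 1 ≤ n) (G : SimpleGraph (Fin n))
    (hG : G.Colorable 2) :
    ∃ w : Option (Fin n × Fin n × Bool) → ℝ,
      ip1 n w (e1 n none) = 1 ∧
      (∀ x ∈ P1avail n G, ip1 n w x = 0) ∧
      (∑ k : Fin n, ∑ u : Fin n, ∑ v : Fin n,
          (if u ≠ v then
            (ip1 n w (e1 n (some (u, k, false)) + e1 n (some (v, k, true)))) ^ 2
           else 0)) +
        (∑ k : Fin n,
          (ip1 n w
            (e1 n none + e1 n (some (k, k, false)) + e1 n (some (k, k, true)))) ^ 2)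
        ≤ (n : ℝ) + (n : ℝ) ^ 3 := by
  obtain ⟨s, hs, hadj⟩ := hG.exists_sign
  let w : Option (Fin n × Fin n × Bool) → ℝ
    | none => 1
    | some (u, k, _) => -(s u * s k) / 2
  have hfree (k : Fin n) :
      ip1 n w (e1 n none + e1 n (some (k, k, false)) + e1 n (some (k, k, true))) = 0 := by
    simp only [ip1_add, ip1_e1, w]
    rcases hs k with h | h <;> norm_num [h]
  have hedge (k u v : Fin n) :
      ip1 n w (e1 n (some (u, k, false)) + e1 n (some (v, k, true))) =
        -((s u + s v) * s k) / 2 := by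
    simp only [ip1_add, ip1_e1, w]
    ring
  refine ⟨w, by rw [ip1_e1], ?_, ?_⟩
  · rintro x (⟨k, rfl⟩ | ⟨k, u, v, h, rfl⟩)
    · exact hfree k
    · rw [hedge, hadj u v h]
      simp
  · have hterm (k u v : Fin n) :
        (if u ≠ v then
          (ip1 n w (e1 n (some (u, k, false)) + e1 n (some (v, k, true)))) ^ 2
         else 0) ≤ (1 : ℝ) := by
      split_ifs
      · rw [hedge]
        rcases hs u with hu | hu <;> rcases hs v with hv | hv <;>
          rcases hs k with hk | hk <;> norm_num [hu, hv, hk]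
      · exact zero_le_one
    have hsum := Finset.sum_le_sum fun k (_ : k ∈ Finset.univ) =>
      Finset.sum_le_sum fun u (_ : u ∈ Finset.univ) =>
        Finset.sum_le_sum fun v (_ : v ∈ Finset.univ) => hterm k u v
    have hcard : ∑ _k : Fin n, ∑ _u : Fin n, ∑ _v : Fin n, (1 : ℝ) = (n : ℝ) ^ 3 := by
      simp
      ring
    rw [hcard] at hsum
    have hfree_sum : ∑ k : Fin n, (ip1 n w
        (e1 n none + e1 n (some (k, k, false)) + e1 n (some (k, k, true)))) ^ 2 = 0 :=
      Finset.sum_eq_zero fun k _ => by simp [hfree k]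
    rw [hfree_sum]
    have hn0 : (0 : ℝ) ≤ n := n.cast_nonneg
    linarith
end

section
/- Let n ≥ 1, let G be a simple graph on Fin n, and fix a vertex k : Fin n. In the real vector space (Fin n × Bool) → ℝ with standard basis e, the vector e (k,false) + e (k,true) lies in the real linear span of the set { e (u,b) + e (v,¬b) : G.Adj u v, b : Bool } if and only if there exists a closed walk in G from k to k of odd length. -/
/-- The standard basis vector `e i` in the space `(Fin n × Bool) → ℝ`. -/
noncomputable def eb (n : ℕ) (i : Fin n × Bool) : Fin n × Bool → ℝ :=
  Pi.single i 1

/-- The span of the vectors `e (u, b) + e (v, !b)` over the edges `uv` of `G`, that is, the edge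
space of the bipartite double cover of `G`. -/
def doubleCoverSpan {n : ℕ} (G : SimpleGraph (Fin n)) : Submodule ℝ (Fin n × Bool → ℝ) :=
  Submodule.span ℝ
    {x : Fin n × Bool → ℝ | ∃ u v : Fin n, ∃ b : Bool,
      G.Adj u v ∧ x = eb n (u, b) + eb n (v, !b)}

theorem eb_mem_doubleCoverSpan_of_walk {n : ℕ} {G : SimpleGraph (Fin n)} {u v : Fin n}
    (p : G.Walk u v) (b : Bool) :
    (Even p.length → eb n (u, b) - eb n (v, b) ∈ doubleCoverSpan G) ∧
      (Odd p.length → eb n (u, b) + eb n (v, !b) ∈ doubleCoverSpan G) := by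
  induction p generalizing b with
  | nil => simp
  | @cons u w v h p ih =>
    have hmem : eb n (u, b) + eb n (w, !b) ∈ doubleCoverSpan G :=
      Submodule.subset_span ⟨u, w, b, h, rfl⟩
    rw [SimpleGraph.Walk.length_cons]
    constructor
    · intro hp
      have hsum := (ih (!b)).2 (by grind)
      rw [Bool.not_not] at hsum
      convert Submodule.sub_mem _ hmem hsum using 1
      abel
    · intro hp
      convert Submodule.sub_mem _ hmem ((ih (!b)).1 (by grind)) using 1
      abel

/-- The pair `(v, b)` is joined to `(k, false)` in the bipartite double cover of `G`. -/
def DoubleCoverReachable {n : ℕ} (G : SimpleGraph (Fin n)) (k : Fin n) (x : Fin n × Bool) : Prop :=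
  ∃ p : G.Walk k x.1, Odd p.length ↔ x.2 = true

theorem DoubleCoverReachable.step {n : ℕ} {G : SimpleGraph (Fin n)} {k u v : Fin n} {b : Bool}
    (h : G.Adj u v) (hu : DoubleCoverReachable G k (u, b)) :
    DoubleCoverReachable G k (v, !b) := by
  obtain ⟨p, hp⟩ := hu
  refine ⟨p.concat h, ?_⟩
  rw [SimpleGraph.Walk.length_concat, Nat.odd_add_one, hp]
  simp

theorem doubleCoverReachable_iff_of_adj {n : ℕ} {G : SimpleGraph (Fin n)} {k u v : Fin n}
    {b : Bool} (h : G.Adj u v) :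
    DoubleCoverReachable G k (u, b) ↔ DoubleCoverReachable G k (v, !b) :=
  ⟨.step h, fun hv => by simpa using hv.step h.symm⟩

open Classical in
/-- The `±1` colouring of the component of `(k, false)` in the bipartite double cover of `G`,
extended by zero. -/
noncomputable def componentSign {n : ℕ} (G : SimpleGraph (Fin n)) (k : Fin n) (x : Fin n × Bool) :
    ℝ :=
  if DoubleCoverReachable G k x then (if x.2 then -1 else 1) else 0

theorem componentSign_add_of_adj {n : ℕ} {G : SimpleGraph (Fin n)} {k u v : Fin n} {b : Bool}
    (h : G.Adj u v) : componentSign G k (u, b) + componentSign G k (v, !b) = 0 := by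
  have hiff := doubleCoverReachable_iff_of_adj (k := k) (b := b) h
  by_cases hu : DoubleCoverReachable G k (u, b) <;> cases b <;> simp_all [componentSign]

theorem componentSign_dotProduct_eq_zero {n : ℕ} {G : SimpleGraph (Fin n)} {k : Fin n}
    {x : Fin n × Bool → ℝ} (hx : x ∈ doubleCoverSpan G) : componentSign G k ⬝ᵥ x = 0 := by
  induction hx using Submodule.span_induction with
  | mem x hx =>
    obtain ⟨u, v, b, h, rfl⟩ := hx
    simpa [eb, dotProduct_add] using componentSign_add_of_adj h
  | zero => simp
  | add x y _ _ hx hy => rw [dotProduct_add, hx, hy, add_zero]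
  | smul a x _ hx => rw [dotProduct_smul, hx, smul_zero]

theorem stmt3 (n : ℕ) (hn : 1 ≤ n) (G : SimpleGraph (Fin n)) (k : Fin n) :
    eb n (k, false) + eb n (k, true) ∈
      Submodule.span ℝ
        {x : Fin n × Bool → ℝ | ∃ u v : Fin n, ∃ b : Bool,
          G.Adj u v ∧ x = eb n (u, b) + eb n (v, !b)} ↔
    ∃ p : G.Walk k k, Odd p.length := by
  refine ⟨fun h => ?_, fun ⟨p, hp⟩ => (eb_mem_doubleCoverSpan_of_walk p false).2 hp⟩
  by_contra hodd
  have hzero := componentSign_dotProduct_eq_zero (k := k) h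
  have hfalse : DoubleCoverReachable G k (k, false) := ⟨.nil, by simp⟩
  have htrue : ¬ DoubleCoverReachable G k (k, true) := fun ⟨p, hp⟩ => hodd ⟨p, hp.2 rfl⟩
  simp [eb, dotProduct_add, componentSign, hfalse, htrue] at hzero
end

section
/- Let V be a finite type, let G be a simple graph on V, and let s t : V. In the real vector space V → ℝ with standard basis e, the vector e s − e t lies in the real linear span of the set { e u − e v : G.Adj u v } if and only if s and t are in the same connected component of G (i.e., G.Reachable s t). -/
theorem stmt4 {V : Type*} [Fintype V] [DecidableEq V] (G : SimpleGraph V) (s t : V) :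
    (Pi.single s (1 : ℝ) - Pi.single t 1) ∈
      Submodule.span ℝ
        {x : V → ℝ | ∃ u v : V, G.Adj u v ∧
          x = Pi.single u (1 : ℝ) - Pi.single v 1} ↔
    G.Reachable s t := by
  classical
  constructor
  · intro h
    by_contra hst
    -- Pair with the indicator function of the connected component of `s`.
    let c : V → ℝ := fun i => if G.Reachable s i then 1 else 0
    have key : c ⬝ᵥ (Pi.single s (1 : ℝ) - Pi.single t 1) = 0 := by
      generalize (Pi.single s (1 : ℝ) - Pi.single t 1 : V → ℝ) = y at h ⊢
      induction h using Submodule.span_induction with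
      | mem x hx =>
        obtain ⟨u, v, huv, rfl⟩ := hx
        have hiff : G.Reachable s u ↔ G.Reachable s v :=
          ⟨fun h => h.trans huv.reachable, fun h => h.trans huv.symm.reachable⟩
        simp [c, dotProduct_sub, hiff]
      | zero => simp
      | add x y _ _ hx hy => rw [dotProduct_add, hx, hy, add_zero]
      | smul a x _ hx => rw [dotProduct_smul, hx, smul_zero]
    simp [c, dotProduct_sub, hst] at key
  · rintro ⟨p⟩
    induction p with
    | nil => simp
    | @cons u v w huv _ ih =>
      rw [← sub_add_sub_cancel _ (Pi.single v (1 : ℝ))]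
      exact add_mem (Submodule.subset_span ⟨u, v, huv, rfl⟩) ih
end

section
/- Let V be a finite type with n elements, let G be a simple graph on V, and let s t : V with G.Reachable s t. Then there exists a function c : V × V → ℝ that vanishes on every pair (u,v) with ¬ G.Adj u v, such that the sum over all ordered pairs (u,v) of c (u,v) • (e u − e v) equals e s − e t, and the sum over all ordered pairs of (c (u,v))² is at most n − 1. -/
/-- A path from `s` to `t` carries a unit flow, whose energy is the length of the path. -/
theorem SimpleGraph.Walk.IsPath.exists_unit_flow {V : Type*} [Fintype V] [DecidableEq V]
    {G : SimpleGraph V} {s t : V} {w : G.Walk s t} (hw : w.IsPath) :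
    ∃ c : V × V → ℝ,
      (∀ u v : V, ¬ G.Adj u v → c (u, v) = 0) ∧
      (∀ u v : V, u ∉ w.support → c (u, v) = 0) ∧
      (∑ p : V × V, c p • (Pi.single p.1 1 - Pi.single p.2 1 : V → ℝ)) =
        (Pi.single s 1 - Pi.single t 1 : V → ℝ) ∧
      (∑ p : V × V, (c p) ^ 2) = w.length := by
  induction w with
  | nil => exact ⟨0, by simp⟩
  | @cons a b t hab q ih =>
    rw [SimpleGraph.Walk.cons_isPath_iff] at hw
    obtain ⟨c, hadj, hsupp, hsum, hsq⟩ := ih hw.1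
    refine ⟨c + Pi.single (a, b) 1, fun u v huv => ?_, fun u v hu => ?_, ?_, ?_⟩
    · have hne : (u, v) ≠ (a, b) := by
        rintro ⟨⟩
        exact huv hab
      simp [hadj u v huv, Pi.single_eq_of_ne hne]
    · rw [SimpleGraph.Walk.support_cons, List.mem_cons, not_or] at hu
      have hne : (u, v) ≠ (a, b) := fun e => hu.1 (congrArg Prod.fst e)
      simp [hsupp u v hu.2, Pi.single_eq_of_ne hne]
    · simp only [Pi.add_apply, add_smul, Finset.sum_add_distrib, hsum]
      simp [Pi.single_apply (a, b), ite_smul]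
    · have hpt (p : V × V) : (c p + (Pi.single (a, b) 1 : V × V → ℝ) p) ^ 2 =
          c p ^ 2 + (Pi.single (a, b) 1 : V × V → ℝ) p := by
        by_cases hp : p = (a, b)
        · subst hp
          simp [hsupp a b hw.2]
        · simp [Pi.single_eq_of_ne hp]
      simp [hpt, Finset.sum_add_distrib, hsq]

theorem stmt5 {V : Type*} [Fintype V] [DecidableEq V] (n : ℕ)
    (hcard : Fintype.card V = n) (G : SimpleGraph V) (s t : V)
    (h : G.Reachable s t) :
    ∃ c : V × V → ℝ,
      (∀ u v : V, ¬ G.Adj u v → c (u, v) = 0) ∧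
      (∑ p : V × V, c p • (Pi.single p.1 1 - Pi.single p.2 1 : V → ℝ)) =
        (Pi.single s 1 - Pi.single t 1 : V → ℝ) ∧
      (∑ p : V × V, (c p) ^ 2) ≤ (n : ℝ) - 1 := by
  obtain ⟨w, hw⟩ := h.exists_isPath
  obtain ⟨c, hadj, -, hsum, hsq⟩ := hw.exists_unit_flow
  refine ⟨c, hadj, hsum, ?_⟩
  have hlen : w.length + 1 ≤ n := hcard ▸ hw.length_lt
  rw [hsq, le_sub_iff_add_le]
  exact_mod_cast hlen
end

section
/- Let n ≥ 1 and let G be a simple graph on Fin n. The target vector t = Σ_{k ∈ K} e (none, k) lies in the real linear span of the available vectors of the connectivity span program P2 if and only if G is connected. -/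
/-- The index set `K` of the subroutines of the connectivity span program `P2`:
all vertices of `Fin n` other than vertex `0`. -/
abbrev Kt (n : ℕ) : Type := {k : Fin n // (k : ℕ) ≠ 0}

/-- The standard basis vector `e i` in the space `(Option (Fin n) × K) → ℝ`. -/
noncomputable def e2 (n : ℕ) (i : Option (Fin n) × Kt n) :
    Option (Fin n) × Kt n → ℝ :=
  Pi.single i 1

/-- The free vector of the connectivity span program `P2` attached to `k ∈ K`. -/
noncomputable def P2free (n : ℕ) (hn : 1 ≤ n) (k : Kt n) :
    Option (Fin n) × Kt n → ℝ :=
  e2 n (none, k) + e2 n (some ⟨0, hn⟩, k) - e2 n (some k.val, k)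

/-- The available vectors of the connectivity span program `P2`. -/
noncomputable def P2avail (n : ℕ) (hn : 1 ≤ n) (G : SimpleGraph (Fin n)) :
    Set (Option (Fin n) × Kt n → ℝ) :=
  {x | (∃ k : Kt n, x = P2free n hn k) ∨
       (∃ k : Kt n, ∃ u v : Fin n, G.Adj u v ∧
          x = e2 n (some u, k) - e2 n (some v, k))}

/-- The target vector of the connectivity span program `P2`. -/
noncomputable def P2target (n : ℕ) : Option (Fin n) × Kt n → ℝ :=
  ∑ k : Kt n, e2 n (none, k)

theorem sub_mem_span_P2avail_of_reachable {n : ℕ} (hn : 1 ≤ n) {G : SimpleGraph (Fin n)}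
    (k : Kt n) {u v : Fin n} (h : G.Reachable u v) :
    e2 n (some u, k) - e2 n (some v, k) ∈ Submodule.span ℝ (P2avail n hn G) := by
  obtain ⟨p⟩ := h
  induction p with
  | nil => simp
  | @cons u v w huv _ ih =>
    have huv' : e2 n (some u, k) - e2 n (some v, k) ∈ Submodule.span ℝ (P2avail n hn G) :=
      Submodule.subset_span (Or.inr ⟨k, u, v, huv, rfl⟩)
    simpa using add_mem huv' ih

open Classical in
/-- The linear functional summing the coordinates `(none, k)` and `(some u, k)` for `u` in the
connected component of `k`. -/
noncomputable def componentFunctional {n : ℕ} (G : SimpleGraph (Fin n)) (k : Kt n) :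
    (Option (Fin n) × Kt n → ℝ) →ₗ[ℝ] ℝ :=
  Fintype.linearCombination ℝ
    fun i => if i.2 = k ∧ ∀ u ∈ i.1, G.Reachable k.val u then (1 : ℝ) else 0

open Classical in
theorem componentFunctional_e2 {n : ℕ} (G : SimpleGraph (Fin n)) (k : Kt n)
    (i : Option (Fin n) × Kt n) :
    componentFunctional G k (e2 n i) =
      if i.2 = k ∧ ∀ u ∈ i.1, G.Reachable k.val u then 1 else 0 := by
  simp [componentFunctional, e2, Fintype.linearCombination_apply_single]

theorem componentFunctional_P2target {n : ℕ} (G : SimpleGraph (Fin n)) (k : Kt n) :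
    componentFunctional G k (P2target n) = 1 := by
  simp [P2target, componentFunctional_e2]

theorem componentFunctional_eq_zero {n : ℕ} (hn : 1 ≤ n) {G : SimpleGraph (Fin n)} {k : Kt n}
    (hk : ¬ G.Reachable k.val ⟨0, hn⟩) {x : Option (Fin n) × Kt n → ℝ}
    (hx : x ∈ Submodule.span ℝ (P2avail n hn G)) : componentFunctional G k x = 0 := by
  refine (Submodule.span_le (p := LinearMap.ker (componentFunctional G k))).2 ?_ hx
  rintro _ (⟨l, rfl⟩ | ⟨l, u, v, huv, rfl⟩)
  · by_cases hl : l = k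
    · subst hl
      simp [P2free, componentFunctional_e2, hk]
    · simp [P2free, componentFunctional_e2, hl]
  · have h : G.Reachable k.val u ↔ G.Reachable k.val v :=
      ⟨fun h => h.trans huv.reachable, fun h => h.trans huv.symm.reachable⟩
    by_cases hv : G.Reachable k.val v <;> simp [componentFunctional_e2, h, hv]

theorem stmt7 (n : ℕ) (hn : 1 ≤ n) (G : SimpleGraph (Fin n)) :
    P2target n ∈ Submodule.span ℝ (P2avail n hn G) ↔ G.Connected := by
  constructor
  · intro ht
    have hr : ∀ v : Fin n, G.Reachable v ⟨0, hn⟩ := by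
      intro v
      by_cases hv : (v : ℕ) = 0
      · rw [show v = ⟨0, hn⟩ from Fin.ext hv]
      · by_contra hk
        have h := componentFunctional_eq_zero hn (k := ⟨v, hv⟩) hk ht
        rw [componentFunctional_P2target] at h
        exact one_ne_zero h
    exact { preconnected := fun u v => (hr u).trans (hr v).symm, nonempty := ⟨⟨0, hn⟩⟩ }
  · intro hG
    refine Submodule.sum_mem _ fun k _ => ?_
    have hfree : P2free n hn k ∈ Submodule.span ℝ (P2avail n hn G) :=
      Submodule.subset_span (Or.inl ⟨k, rfl⟩)
    have hpath := sub_mem_span_P2avail_of_reachable hn k (hG.preconnected k.val ⟨0, hn⟩)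
    have h := add_mem hfree hpath
    rwa [P2free, show ∀ a b c : Option (Fin n) × Kt n → ℝ, a + b - c + (c - b) = a by
      intros; abel] at h
end

section
/- Let n ≥ 1 and let G be a connected simple graph on Fin n. Then there exists a finitely supported family of real coefficients, one for each available vector of the connectivity span program P2, such that the corresponding linear combination of available vectors equals the target vector t = Σ_{k ∈ K} e (none, k), and the sum of the squares of the coefficients is at most n². -/
/-- The vectors of the connectivity span program `P2`, indexed by `Sum.inl k` for the
free vector attached to `k ∈ K`, and by `Sum.inr (k, u, v)` for the vector attached to
subspace `k` and the ordered pair `(u, v)`. -/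
noncomputable def P2vec (n : ℕ) (hn : 1 ≤ n) :
    (Kt n ⊕ Kt n × Fin n × Fin n) → Option (Fin n) × Kt n → ℝ
  | Sum.inl k => e2 n (none, k) + e2 n (some ⟨0, hn⟩, k) - e2 n (some k.val, k)
  | Sum.inr (k, u, v) => e2 n (some u, k) - e2 n (some v, k)

/-- A path carries a unit flow between its endpoints, supported on the edges of the graph, whose
energy is the length of the path. -/
theorem exists_unit_flow_of_isPath {V M : Type*} [Fintype V] [DecidableEq V] [AddCommGroup M]
    [Module ℝ M] {G : SimpleGraph V} {a b : V} (p : G.Walk a b) (hp : p.IsPath) (g : V → M) :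
    ∃ f : V × V → ℝ, (∀ u v, ¬ G.Adj u v → f (u, v) = 0) ∧
      (∀ u v, u ∉ p.support → f (u, v) = 0) ∧
      ∑ x, f x • (g x.1 - g x.2) = g a - g b ∧ ∑ x, f x ^ 2 = p.length := by
  induction p with
  | nil => exact ⟨0, by simp⟩
  | @cons a c b h p ih =>
    rw [SimpleGraph.Walk.cons_isPath_iff] at hp
    obtain ⟨f, hadj, hsupp, hflow, hsq⟩ := ih hp.1
    have hac : f (a, c) = 0 := hsupp a c hp.2
    refine ⟨f + Pi.single (a, c) 1, fun u v huv => ?_, fun u v hu => ?_, ?_, ?_⟩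
    · have hne : (u, v) ≠ (a, c) := by
        rintro ⟨⟩
        exact huv h
      simp [hadj u v huv, hne]
    · rw [SimpleGraph.Walk.support_cons, List.mem_cons, not_or] at hu
      simp [hsupp u v hu.2, hu.1]
    · simp only [Pi.add_apply, add_smul, Finset.sum_add_distrib, hflow, Pi.single_apply, ite_smul,
        one_smul, zero_smul, Finset.sum_ite_eq', Finset.mem_univ, if_true]
      abel
    · have hpt (x : V × V) :
          (f + Pi.single (a, c) 1 : V × V → ℝ) x ^ 2 = f x ^ 2 + if x = (a, c) then 1 else 0 := by
        by_cases hx : x = (a, c)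
        · subst hx
          simp [hac]
        · simp [hx]
      simp [-Pi.add_apply, hpt, Finset.sum_add_distrib, hsq]

theorem stmt8 (n : ℕ) (hn : 1 ≤ n) (G : SimpleGraph (Fin n))
    (hG : G.Connected) :
    ∃ c : (Kt n ⊕ Kt n × Fin n × Fin n) → ℝ,
      (∀ (k : Kt n) (u v : Fin n), ¬ G.Adj u v → c (Sum.inr (k, u, v)) = 0) ∧
      (∑ i, c i • P2vec n hn i) = P2target n ∧
      (∑ i, (c i) ^ 2) ≤ (n : ℝ) ^ 2 := by
  have hflow (k : Kt n) : ∃ f : Fin n × Fin n → ℝ, (∀ u v, ¬ G.Adj u v → f (u, v) = 0) ∧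
      ∑ x, f x • (e2 n (some x.1, k) - e2 n (some x.2, k)) =
        e2 n (some k.val, k) - e2 n (some ⟨0, hn⟩, k) ∧
      1 + ∑ x, f x ^ 2 ≤ (n : ℝ) := by
    obtain ⟨p, hp⟩ := hG.exists_isPath k.val ⟨0, hn⟩
    obtain ⟨f, hadj, -, hsum, hsq⟩ :=
      exists_unit_flow_of_isPath p hp fun u => e2 n (some u, k)
    refine ⟨f, hadj, hsum, ?_⟩
    have hlen := hp.length_lt
    rw [Fintype.card_fin] at hlen
    rw [hsq]
    exact_mod_cast (by omega : 1 + p.length ≤ n)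
  choose f hadj hsum hsq using hflow
  refine ⟨Sum.elim (fun _ => 1) fun x => f x.1 x.2, fun k u v huv => hadj k u v huv, ?_, ?_⟩
  · rw [Fintype.sum_sum_type, Fintype.sum_prod_type, ← Finset.sum_add_distrib, P2target]
    refine Finset.sum_congr rfl fun k _ => ?_
    simp only [Sum.elim_inl, Sum.elim_inr, P2vec, one_smul, hsum]
    abel
  · rw [Fintype.sum_sum_type, Fintype.sum_prod_type, ← Finset.sum_add_distrib]
    simp only [Sum.elim_inl, Sum.elim_inr, one_pow]
    have hcard : (Fintype.card (Kt n) : ℝ) ≤ n := by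
      exact_mod_cast (Fintype.card_subtype_le _).trans_eq (Fintype.card_fin n)
    calc ∑ k : Kt n, (1 + ∑ x, f k x ^ 2) ≤ ∑ _k : Kt n, (n : ℝ) :=
          Finset.sum_le_sum fun k _ => hsq k
      _ = Fintype.card (Kt n) * (n : ℝ) := by simp
      _ ≤ (n : ℝ) ^ 2 := by
          rw [sq]
          gcongr
end
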